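/- For all processes P and Q and every S ⊆ A: rfft(P ∥_S Q) = col(rfft(P) ∥_S rfft(Q)), where ∥_S on sets of rooted partial failure traces is the extension of the valid-decomposition composition described below. -/

import Mathlib

/-! ### The process algebra CCSP_t

The countably infinite set `A` of visible actions and the countably infinite set `V`
of variables are both taken to be `ℕ`. -/

/-- Actions: visible actions from `A = ℕ`, the hidden action `τ`,
and the time-out action `t`. -/
inductive Act : Type
  | act : ℕ → Act
  | tau : Act
  | timeout : Act

/-- CCSP_t expressions.  A recursive specification `S` is represented as a partial
function `ℕ → Option Expr`; its domain is the set `V_S` of bound variables, and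
`⟨X|S⟩` is written `Expr.fix X S`. -/
inductive Expr : Type
  | nil : Expr
  | pre : Act → Expr → Expr
  | choice : Expr → Expr → Expr
  | par : Set ℕ → Expr → Expr → Expr
  | abs : Set ℕ → Expr → Expr
  | ren : Set (ℕ × ℕ) → Expr → Expr
  | var : ℕ → Expr
  | fix : ℕ → (ℕ → Option Expr) → Expr

/-- `α.notIn S`: the action `α` is not a visible action belonging to `S ⊆ A`. -/
def Act.notIn (α : Act) (S : Set ℕ) : Prop := ∀ a : ℕ, α = Act.act a → a ∉ S

/-- Relational substitution: `Subst ρ E E'` holds iff `E'` is the result of replacing,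
in `E`, every free occurrence of each variable `Y` in the domain of `ρ` by the
expression `ρ Y` (occurrences bound by an inner recursion are not replaced). -/
inductive Subst : (ℕ → Option Expr) → Expr → Expr → Prop
  | nil {ρ} : Subst ρ .nil .nil
  | pre {ρ α E E'} : Subst ρ E E' → Subst ρ (.pre α E) (.pre α E')
  | choice {ρ E F E' F'} : Subst ρ E E' → Subst ρ F F' →
      Subst ρ (.choice E F) (.choice E' F')
  | par {ρ S E F E' F'} : Subst ρ E E' → Subst ρ F F' →
      Subst ρ (.par S E F) (.par S E' F')
  | abs {ρ I E E'} : Subst ρ E E' → Subst ρ (.abs I E) (.abs I E')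
  | ren {ρ R E E'} : Subst ρ E E' → Subst ρ (.ren R E) (.ren R E')
  | varNone {ρ Y} : ρ Y = none → Subst ρ (.var Y) (.var Y)
  | varSome {ρ Y F} : ρ Y = some F → Subst ρ (.var Y) F
  | fix {ρ Z} {T T' : ℕ → Option Expr} :
      (∀ Y, T Y = none ↔ T' Y = none) →
      (∀ Y E E', T Y = some E → T' Y = some E' →
          Subst (fun W => if (T W).isSome then none else ρ W) E E') →
      Subst ρ (.fix Z T) (.fix Z T')

/-- The substitution replacing each bound variable `Y` of `S` by `⟨Y|S⟩`. -/
def recmap (S : ℕ → Option Expr) : ℕ → Option Expr :=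
  fun Y => (S Y).map (fun _ => Expr.fix Y S)

/-- The structural operational (interleaving) semantics of CCSP_t. -/
inductive Step : Expr → Act → Expr → Prop
  | pre {α E} : Step (.pre α E) α E
  | choiceL {E F α E'} : Step E α E' → Step (.choice E F) α E'
  | choiceR {E F α F'} : Step F α F' → Step (.choice E F) α F'
  | renTau {R E E'} : Step E .tau E' → Step (.ren R E) .tau (.ren R E')
  | renTimeout {R E E'} : Step E .timeout E' →
      Step (.ren R E) .timeout (.ren R E')
  | renAct {R E E' a b} : Step E (.act a) E' → (a, b) ∈ R →
      Step (.ren R E) (.act b) (.ren R E')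
  | parL {S E F α E'} : Step E α E' → α.notIn S →
      Step (.par S E F) α (.par S E' F)
  | parR {S E F α F'} : Step F α F' → α.notIn S →
      Step (.par S E F) α (.par S E F')
  | parSync {S E F a E' F'} : Step E (.act a) E' → Step F (.act a) F' → a ∈ S →
      Step (.par S E F) (.act a) (.par S E' F')
  | absFree {I E α E'} : Step E α E' → α.notIn I →
      Step (.abs I E) α (.abs I E')
  | absHide {I E a E'} : Step E (.act a) E' → a ∈ I →
      Step (.abs I E) .tau (.abs I E')
  | fixUnfold {X S E E' α F} : S X = some E → Subst (recmap S) E E' →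
      Step E' α F → Step (.fix X S) α F

/-- Free occurrence of a variable in a CCSP_t expression. -/
inductive Free (x : ℕ) : Expr → Prop
  | pre {α E} : Free x E → Free x (.pre α E)
  | choiceL {E F} : Free x E → Free x (.choice E F)
  | choiceR {E F} : Free x F → Free x (.choice E F)
  | parL {S E F} : Free x E → Free x (.par S E F)
  | parR {S E F} : Free x F → Free x (.par S E F)
  | abs {I E} : Free x E → Free x (.abs I E)
  | ren {R E} : Free x E → Free x (.ren R E)
  | var : Free x (.var x)
  | fix {Z T Y E} : T Y = some E → Free x E → T x = none → Free x (.fix Z T)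

/-- An expression is closed if no variable occurs free in it. -/
def Closed (E : Expr) : Prop := ∀ x, ¬ Free x E

/-- Well-formedness: in every recursion `⟨X|S⟩` occurring in the expression the
variable `X` is bound by `S`, and every relational renaming occurring in it has
finite images `{b | (a,b) ∈ R}`. -/
inductive WF : Expr → Prop
  | nil : WF .nil
  | pre {α E} : WF E → WF (.pre α E)
  | choice {E F} : WF E → WF F → WF (.choice E F)
  | par {S E F} : WF E → WF F → WF (.par S E F)
  | abs {I E} : WF E → WF (.abs I E)
  | ren {R E} : (∀ a : ℕ, {b | (a, b) ∈ R}.Finite) → WF E → WF (.ren R E)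
  | var {X} : WF (.var X)
  | fix {X T} : (T X).isSome → (∀ Y E, T Y = some E → WF E) → WF (.fix X T)

/-- `ℙ`: a process is a closed well-formed CCSP_t expression. -/
def IsProcess (E : Expr) : Prop := Closed E ∧ WF E

/-- A process is stable if it has no outgoing τ-transitions. -/
def stable (P : Expr) : Prop := ¬ ∃ P', Step P .tau P'

/-- The set `I(P)` of initial visible actions of a process. -/
def initials (P : Expr) : Set ℕ := {a | ∃ P', Step P (.act a) P'}

/-! ### Partial failure traces -/

/-- An element of a partial failure trace: a visible action `a ∈ A`
or a refusal set `X ⊆ A`. -/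
abbrev Elt : Type := Sum ℕ (Set ℕ)

/-- Partial failure traces: sequences over `A ∪ 𝒫(A)`; the final tag `⊤` is
left implicit. -/
abbrev PFT : Type := List Elt

/-- The set of partial failure traces of a process (Table 3). -/
inductive fft : Expr → PFT → Prop
  | top {P} : fft P []
  | act {P Q a ρ} : Step P (.act a) Q → fft Q ρ → fft P (Sum.inl a :: ρ)
  | tau {P Q ρ} : Step P .tau Q → fft Q ρ → fft P ρ
  | refusal {P X ρ} : (∀ a ∈ X, a ∉ initials P) → stable P → fft P ρ →
      fft P (Sum.inr X :: ρ)
  | timeoutRef {P Q X ρ} : (∀ a ∈ X, a ∉ initials P) → stable P →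
      Step P .timeout Q → fft Q (Sum.inr X :: ρ) → fft P (Sum.inr X :: ρ)
  | timeoutAct {P Q X a ρ} : (∀ a' ∈ X, a' ∉ initials P) → stable P →
      Step P .timeout Q → fft Q (Sum.inl a :: ρ) → a ∈ X →
      fft P (Sum.inr X :: Sum.inl a :: ρ)

def fftSet (P : Expr) : Set PFT := {σ | fft P σ}

/-! ### Rooted partial failure traces -/

/-- Rooted partial failure traces: ordinary partial failure traces, traces
`t·Xσ` starting with a time-out transition (represented as `rooted X σ`,
standing for the trace `Xσ` preceded by `t`), and the two tags `st`
and `post-st`. -/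
inductive RPFT : Type
  | plain : PFT → RPFT
  | rooted : Set ℕ → PFT → RPFT
  | st : RPFT
  | postst : RPFT

/-- The set `rfft(P)` of rooted partial failure traces of a process. -/
def rfftSet (P : Expr) : Set RPFT :=
  {r |
    (∃ σ, r = RPFT.plain σ ∧ fft P σ) ∨
    (r = RPFT.st ∧ stable P) ∨
    (∃ X σ, r = RPFT.rooted X σ ∧ stable P ∧ (∀ a ∈ X, a ∉ initials P) ∧
      ∃ P', Step P .timeout P' ∧ fft P' (Sum.inr X :: σ)) ∨
    (r = RPFT.postst ∧ (∃ P', Step P .tau P') ∧ fft P [Sum.inr (∅ : Set ℕ)])}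

/-! ### Decomposition of partial failure traces w.r.t. a synchronisation set -/

/-- Pointwise decomposition of an element of a partial failure trace into left and
right components (`none` plays the role of the placeholder `⋆`): actions in `S`
go to both sides, actions outside `S` to exactly one side, and refusal sets are
split into a pair of refusal sets. -/
def EltDecomp (S : Set ℕ) : Elt → Option Elt → Option Elt → Prop
  | Sum.inl a, l, r =>
      (a ∈ S ∧ l = some (Sum.inl a) ∧ r = some (Sum.inl a)) ∨
      (a ∉ S ∧ ((l = some (Sum.inl a) ∧ r = none) ∨ (l = none ∧ r = some (Sum.inl a))))
  | Sum.inr _, l, r =>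
      (∃ XL : Set ℕ, l = some (Sum.inr XL)) ∧ (∃ XR : Set ℕ, r = some (Sum.inr XR))

/-- `Decomp S σ L R`: the annotated sequences `L` (= σ^L) and `R` (= σ^R) form a
decomposition of `σ` w.r.t. `S`. -/
inductive Decomp (S : Set ℕ) : PFT → List (Option Elt) → List (Option Elt) → Prop
  | nil : Decomp S [] [] []
  | cons {e l r σ L R} : EltDecomp S e l r → Decomp S σ L R →
      Decomp S (e :: σ) (l :: L) (r :: R)

/-- The occurrence of a refusal set at position `i` of `σ` is system-ended:
it is immediately followed in `σ` by an action belonging to it. -/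
def SysEnded (σ : PFT) (i : ℕ) : Prop :=
  ∃ X a, σ[i]? = some (Sum.inr X) ∧ σ[i + 1]? = some (Sum.inl a) ∧ a ∈ X

/-- The occurrence of a refusal set at position `i` of the annotated sequence `L`
is system-ended in the trace obtained from `L` by deleting all `⋆`s: the next
non-`⋆` element after position `i` is an action belonging to it. -/
def SysEndedAnn (L : List (Option Elt)) (i : ℕ) : Prop :=
  ∃ X a, L[i]? = some (some (Sum.inr X)) ∧
    ((L.drop (i + 1)).reduceOption).head? = some (Sum.inl a) ∧ a ∈ X

/-- A valid decomposition of `σ` w.r.t. `S`. -/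
def ValidDecomp (S : Set ℕ) (σ : PFT) (L R : List (Option Elt)) : Prop :=
  Decomp S σ L R ∧
  ∀ i X, σ[i]? = some (Sum.inr X) →
    (SysEnded σ i ↔ (SysEndedAnn L i ∨ SysEndedAnn R i)) ∧
    ¬(SysEndedAnn L i ∧ SysEndedAnn R i) ∧
    ∀ XL XR, L[i]? = some (some (Sum.inr XL)) → R[i]? = some (some (Sum.inr XR)) →
      XL \ S = X \ S ∧ XR \ S = X \ S ∧ (XL ∩ S) ∪ (XR ∩ S) = X ∩ S

/-- The composition `F ∥_S G` of two sets of partial failure traces. -/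
def parTraces (S : Set ℕ) (F G : Set PFT) : Set PFT :=
  {σ | ∃ L R, ValidDecomp S σ L R ∧ L.reduceOption ∈ F ∧ R.reduceOption ∈ G}

/-- `col F`: the least superset of `F` such that `σXXρ ∈ col F` implies
`σXρ ∈ col F`. -/
inductive col (F : Set PFT) : PFT → Prop
  | base {σ} : σ ∈ F → col F σ
  | dup {σ X ρ} : col F (σ ++ Sum.inr X :: Sum.inr X :: ρ) →
      col F (σ ++ Sum.inr X :: ρ)

def colSet (F : Set PFT) : Set PFT := {σ | col F σ}

/-! ### Composition and collapse for rooted partial failure traces -/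

/-- The composition `F ∥_S G` of two sets of rooted partial failure traces.
For a rooted trace `t·Xσ` the initial `t` is treated like an action outside `S`,
going to exactly one side; rooted traces are included only if `st` belongs to
both `F` and `G`. -/
def rparTraces (S : Set ℕ) (F G : Set RPFT) : Set RPFT :=
  {r |
    (∃ σ L R, r = RPFT.plain σ ∧ ValidDecomp S σ L R ∧
      RPFT.plain L.reduceOption ∈ F ∧ RPFT.plain R.reduceOption ∈ G) ∨
    (∃ X σ L R, r = RPFT.rooted X σ ∧ ValidDecomp S (Sum.inr X :: σ) L R ∧
      RPFT.st ∈ F ∧ RPFT.st ∈ G ∧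
      ((∃ XL σL, L.reduceOption = Sum.inr XL :: σL ∧
          RPFT.rooted XL σL ∈ F ∧ RPFT.plain R.reduceOption ∈ G) ∨
       (∃ XR σR, R.reduceOption = Sum.inr XR :: σR ∧
          RPFT.plain L.reduceOption ∈ F ∧ RPFT.rooted XR σR ∈ G))) ∨
    (r = RPFT.st ∧ RPFT.st ∈ F ∧ RPFT.st ∈ G) ∨
    (r = RPFT.postst ∧
      ((RPFT.postst ∈ F ∧ RPFT.postst ∈ G) ∨ (RPFT.postst ∈ F ∧ RPFT.st ∈ G) ∨
       (RPFT.st ∈ F ∧ RPFT.postst ∈ G)))}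

/-- The collapse operator `col` extended to sets of rooted partial failure traces. -/
inductive rcol (F : Set RPFT) : RPFT → Prop
  | base {r} : r ∈ F → rcol F r
  | dupPlain {σ X ρ} : rcol F (RPFT.plain (σ ++ Sum.inr X :: Sum.inr X :: ρ)) →
      rcol F (RPFT.plain (σ ++ Sum.inr X :: ρ))
  | dupRooted {Y σ X ρ} : rcol F (RPFT.rooted Y (σ ++ Sum.inr X :: Sum.inr X :: ρ)) →
      rcol F (RPFT.rooted Y (σ ++ Sum.inr X :: ρ))
  | dupRootedHead {X σ} : rcol F (RPFT.rooted X (Sum.inr X :: σ)) →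
      rcol F (RPFT.rooted X σ)

def rcolSet (F : Set RPFT) : Set RPFT := {r | rcol F r}

/-! ### Composition of traces without placeholders -/

/-- The trace starts with an action from `X`. -/
def StartsIn (X : Set ℕ) (σ : PFT) : Prop := ∃ a ∈ X, σ.head? = some (Sum.inl a)

theorem startsIn_cons {X : Set ℕ} {a : ℕ} (ha : a ∈ X) (σ : PFT) :
    StartsIn X (Sum.inl a :: σ) := ⟨a, ha, rfl⟩

/-- `Split S σ l r`: the trace `σ` has a valid decomposition `(l, r)` w.r.t. `S`. -/
inductive Split (S : Set ℕ) : PFT → PFT → PFT → Prop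
  | nil : Split S [] [] []
  | sync {a σ l r} : a ∈ S → Split S σ l r →
      Split S (Sum.inl a :: σ) (Sum.inl a :: l) (Sum.inl a :: r)
  | left {a σ l r} : a ∉ S → Split S σ l r → Split S (Sum.inl a :: σ) (Sum.inl a :: l) r
  | right {a σ l r} : a ∉ S → Split S σ l r → Split S (Sum.inl a :: σ) l (Sum.inl a :: r)
  | refusal {X XL XR σ l r} : (StartsIn X σ ↔ StartsIn XL l ∨ StartsIn XR r) →
      ¬(StartsIn XL l ∧ StartsIn XR r) →
      XL \ S = X \ S → XR \ S = X \ S → (XL ∩ S) ∪ (XR ∩ S) = X ∩ S → Split S σ l r →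
      Split S (Sum.inr X :: σ) (Sum.inr XL :: l) (Sum.inr XR :: r)

theorem Split.symm {S σ l r} (h : Split S σ l r) : Split S σ r l := by
  induction h with
  | nil => exact .nil
  | sync ha _ ih => exact .sync ha ih
  | left ha _ ih => exact .right ha ih
  | right ha _ ih => exact .left ha ih
  | refusal h1 h2 h3 h4 h5 _ ih =>
    exact .refusal (h1.trans or_comm) (fun h => h2 h.symm) h4 h3 (by rw [Set.union_comm, h5]) ih

theorem Split.exists_right {S X σ l r} (h : Split S (Sum.inr X :: σ) l r) :
    ∃ XR r', r = Sum.inr XR :: r' := by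
  cases h; exact ⟨_, _, rfl⟩

theorem sysEnded_zero {X : Set ℕ} {σ : PFT} :
    SysEnded (Sum.inr X :: σ) 0 ↔ StartsIn X σ := by
  constructor
  · rintro ⟨Y, a, h1, h2, h3⟩
    simp only [List.getElem?_cons_zero, Option.some.injEq, Sum.inr.injEq] at h1
    subst h1
    exact ⟨a, h3, by simpa [List.head?_eq_getElem?] using h2⟩
  · rintro ⟨a, h1, h2⟩
    exact ⟨X, a, rfl, by simpa [List.head?_eq_getElem?] using h2, h1⟩

theorem sysEndedAnn_zero {X : Set ℕ} {L : List (Option Elt)} :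
    SysEndedAnn (some (Sum.inr X) :: L) 0 ↔ StartsIn X L.reduceOption := by
  constructor
  · rintro ⟨Y, a, h1, h2, h3⟩
    simp only [List.getElem?_cons_zero, Option.some.injEq, Sum.inr.injEq] at h1
    subst h1
    exact ⟨a, h3, by simpa using h2⟩
  · rintro ⟨a, h1, h2⟩
    exact ⟨X, a, rfl, by simpa using h2, h1⟩

theorem sysEnded_succ {e : Elt} {σ : PFT} {i : ℕ} :
    SysEnded (e :: σ) (i + 1) ↔ SysEnded σ i := by
  simp [SysEnded]

theorem sysEndedAnn_succ {l : Option Elt} {L : List (Option Elt)} {i : ℕ} :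
    SysEndedAnn (l :: L) (i + 1) ↔ SysEndedAnn L i := by
  simp [SysEndedAnn]

theorem ValidDecomp.tail {S : Set ℕ} {e l r σ L R}
    (h : ValidDecomp S (e :: σ) (l :: L) (r :: R)) : ValidDecomp S σ L R := by
  obtain ⟨hd, hv⟩ := h
  cases hd with
  | cons _ hd =>
    refine ⟨hd, fun i X hi => ?_⟩
    have := hv (i + 1) X (by simpa using hi)
    simpa [sysEnded_succ, sysEndedAnn_succ] using this

theorem ValidDecomp.cons_act {S : Set ℕ} {a l r σ L R}
    (he : EltDecomp S (Sum.inl a) l r) (h : ValidDecomp S σ L R) :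
    ValidDecomp S (Sum.inl a :: σ) (l :: L) (r :: R) := by
  refine ⟨.cons he h.1, fun i X hi => ?_⟩
  cases i with
  | zero => simp at hi
  | succ i =>
    have := h.2 i X (by simpa using hi)
    simpa [sysEnded_succ, sysEndedAnn_succ] using this

theorem ValidDecomp.split {S σ L R} (h : ValidDecomp S σ L R) :
    Split S σ L.reduceOption R.reduceOption := by
  have hd := h.1
  induction hd with
  | nil => exact .nil
  | @cons e l r σ L R he _ ih =>
    have ih := ih h.tail
    cases e with
    | inl a =>
      rcases he with ⟨ha, rfl, rfl⟩ | ⟨ha, ⟨rfl, rfl⟩ | ⟨rfl, rfl⟩⟩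
      · simpa using Split.sync ha ih
      · simpa using Split.left ha ih
      · simpa using Split.right ha ih
    | inr X =>
      obtain ⟨⟨XL, rfl⟩, ⟨XR, rfl⟩⟩ := he
      obtain ⟨h1, h2, h3⟩ := h.2 0 X rfl
      obtain ⟨h3, h4, h5⟩ := h3 XL XR rfl rfl
      rw [sysEnded_zero, sysEndedAnn_zero, sysEndedAnn_zero] at h1
      rw [sysEndedAnn_zero, sysEndedAnn_zero] at h2
      simpa using Split.refusal h1 h2 h3 h4 h5 ih

theorem Split.exists_validDecomp {S σ l r} (h : Split S σ l r) :
    ∃ L R, ValidDecomp S σ L R ∧ L.reduceOption = l ∧ R.reduceOption = r := by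
  induction h with
  | nil => exact ⟨[], [], ⟨.nil, by simp⟩, rfl, rfl⟩
  | sync ha _ ih =>
    obtain ⟨L, R, h, rfl, rfl⟩ := ih
    exact ⟨_, _, h.cons_act (.inl ⟨ha, rfl, rfl⟩), by simp, by simp⟩
  | left ha _ ih =>
    obtain ⟨L, R, h, rfl, rfl⟩ := ih
    exact ⟨_, _, h.cons_act (.inr ⟨ha, .inl ⟨rfl, rfl⟩⟩), by simp, by simp⟩
  | right ha _ ih =>
    obtain ⟨L, R, h, rfl, rfl⟩ := ih
    exact ⟨_, _, h.cons_act (.inr ⟨ha, .inr ⟨rfl, rfl⟩⟩), by simp, by simp⟩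
  | @refusal X XL XR _ _ _ h1 h2 h3 h4 h5 _ ih =>
    obtain ⟨L, R, h, rfl, rfl⟩ := ih
    refine ⟨some (Sum.inr XL) :: L, some (Sum.inr XR) :: R,
      ⟨.cons ⟨⟨_, rfl⟩, ⟨_, rfl⟩⟩ h.1, fun i Y hi => ?_⟩, by simp, by simp⟩
    cases i with
    | zero =>
      simp only [List.getElem?_cons_zero, Option.some.injEq, Sum.inr.injEq] at hi
      subst hi
      rw [sysEnded_zero, sysEndedAnn_zero, sysEndedAnn_zero]
      refine ⟨h1, h2, ?_⟩
      simp only [List.getElem?_cons_zero, Option.some.injEq, Sum.inr.injEq]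
      rintro _ _ rfl rfl
      exact ⟨h3, h4, h5⟩
    | succ i =>
      have := h.2 i Y (by simpa using hi)
      simpa [sysEnded_succ, sysEndedAnn_succ] using this

/-! ### Stable refusals -/

/-- `P` is stable and has no initial action in `X`. -/
def Refuses (P : Expr) (X : Set ℕ) : Prop := stable P ∧ ∀ a ∈ X, a ∉ initials P

theorem Refuses.mono {P X Y} (h : Refuses P X) (hY : Y ⊆ X) : Refuses P Y :=
  ⟨h.1, fun a ha => h.2 a (hY ha)⟩

theorem notIn_tau (S : Set ℕ) : Act.tau.notIn S := by intro a h; cases h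

theorem notIn_timeout (S : Set ℕ) : Act.timeout.notIn S := by intro a h; cases h

theorem notIn_act {S : Set ℕ} {a : ℕ} (h : a ∉ S) : (Act.act a).notIn S := by
  intro b hb; cases hb; exact h

theorem stable_par_iff {S P Q} : stable (.par S P Q) ↔ stable P ∧ stable Q := by
  constructor
  · exact fun h => ⟨fun ⟨P', hP⟩ => h ⟨_, .parL hP (notIn_tau S)⟩,
      fun ⟨Q', hQ⟩ => h ⟨_, .parR hQ (notIn_tau S)⟩⟩
  · rintro ⟨hP, hQ⟩ ⟨_, h⟩
    cases h with
    | parL h _ => exact hP ⟨_, h⟩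
    | parR h _ => exact hQ ⟨_, h⟩

theorem mem_initials_par_iff {S P Q a} : a ∈ initials (.par S P Q) ↔
    (a ∉ S ∧ (a ∈ initials P ∨ a ∈ initials Q)) ∨
    (a ∈ S ∧ a ∈ initials P ∧ a ∈ initials Q) := by
  constructor
  · rintro ⟨_, h⟩
    cases h with
    | parL h hn => exact .inl ⟨hn a rfl, .inl ⟨_, h⟩⟩
    | parR h hn => exact .inl ⟨hn a rfl, .inr ⟨_, h⟩⟩
    | parSync h h' ha => exact .inr ⟨ha, ⟨_, h⟩, ⟨_, h'⟩⟩
  · rintro (⟨ha, ⟨_, h⟩ | ⟨_, h⟩⟩ | ⟨ha, ⟨_, h⟩, ⟨_, h'⟩⟩)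
    · exact ⟨_, .parL h (notIn_act ha)⟩
    · exact ⟨_, .parR h (notIn_act ha)⟩
    · exact ⟨_, .parSync h h' ha⟩

theorem Refuses.par_symm {S P Q X} (h : Refuses (.par S P Q) X) :
    Refuses (.par S Q P) X := by
  refine ⟨stable_par_iff.2 (stable_par_iff.1 h.1).symm, fun a ha h' => h.2 a ha ?_⟩
  rw [mem_initials_par_iff] at h' ⊢
  tauto

theorem Refuses.par {S P Q X XL XR} (hP : Refuses P XL) (hQ : Refuses Q XR)
    (hL : XL \ S = X \ S) (hR : XR \ S = X \ S) (hS : (XL ∩ S) ∪ (XR ∩ S) = X ∩ S) :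
    Refuses (.par S P Q) X := by
  refine ⟨stable_par_iff.2 ⟨hP.1, hQ.1⟩, fun a ha h => ?_⟩
  have h1 := Set.ext_iff.1 hL a
  have h2 := Set.ext_iff.1 hR a
  have h3 := Set.ext_iff.1 hS a
  have h4 := hP.2 a
  have h5 := hQ.2 a
  rw [mem_initials_par_iff] at h
  simp only [Set.mem_sdiff, Set.mem_union, Set.mem_inter_iff] at h1 h2 h3
  tauto

theorem mem_initials_of_fft {P a ρ} (hs : stable P) (h : fft P (Sum.inl a :: ρ)) :
    a ∈ initials P := by
  cases h with
  | act h _ => exact ⟨_, h⟩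
  | tau h _ => exact absurd ⟨_, h⟩ hs

theorem Refuses.not_startsIn {P X ρ} (hP : Refuses P X) (h : fft P ρ) : ¬ StartsIn X ρ := by
  rintro ⟨a, ha, hh⟩
  obtain ⟨ρ', rfl⟩ : ∃ ρ', ρ = Sum.inl a :: ρ' := by
    cases ρ <;> simp_all
  exact hP.2 a ha (mem_initials_of_fft hP.1 h)

theorem refuses_of_fft {P X ρ} (hs : stable P) (h : fft P (Sum.inr X :: ρ)) : Refuses P X := by
  cases h with
  | tau h _ => exact absurd ⟨_, h⟩ hs
  | refusal h1 _ _ => exact ⟨hs, h1⟩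
  | timeoutRef h1 _ _ _ => exact ⟨hs, h1⟩
  | timeoutAct h1 _ _ _ _ => exact ⟨hs, h1⟩

theorem fft_cons_subset {P X Y ρ} (hY : Y ⊆ X) (h : fft P (Sum.inr X :: ρ)) :
    fft P (Sum.inr Y :: Sum.inr X :: ρ) := by
  generalize hσ : (Sum.inr X :: ρ : PFT) = σ at h
  induction h with
  | top => cases hσ
  | act => cases hσ
  | tau h _ ih => exact .tau h (ih hσ)
  | refusal h1 h2 h3 _ => cases hσ; exact .refusal (fun a ha => h1 a (hY ha)) h2 (.refusal h1 h2 h3)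
  | timeoutRef h1 h2 h3 h4 _ =>
    cases hσ; exact .refusal (fun a ha => h1 a (hY ha)) h2 (.timeoutRef h1 h2 h3 h4)
  | timeoutAct h1 h2 h3 h4 h5 _ =>
    cases hσ; exact .refusal (fun a ha => h1 a (hY ha)) h2 (.timeoutAct h1 h2 h3 h4 h5)

theorem fft_empty_of_fft_cons {P X ρ} (h : fft P (Sum.inr X :: ρ)) :
    fft P [Sum.inr ∅] := by
  generalize hσ : (Sum.inr X :: ρ : PFT) = σ at h
  induction h with
  | top => cases hσ
  | act => cases hσ
  | tau h _ ih => exact .tau h (ih hσ)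
  | refusal _ h2 _ _ => exact .refusal (by simp) h2 .top
  | timeoutRef _ h2 _ _ _ => exact .refusal (by simp) h2 .top
  | timeoutAct _ h2 _ _ _ _ => exact .refusal (by simp) h2 .top

/-! ### Composed traces are traces of the parallel composition -/

theorem fft_par_symm {S P Q σ} (h : fft (.par S P Q) σ) : fft (.par S Q P) σ := by
  have step : ∀ {P Q α E}, Step (.par S P Q) α E →
      ∃ P' Q', E = .par S P' Q' ∧ Step (.par S Q P) α (.par S Q' P') := by
    intro P Q α E h
    cases h with
    | parL h hn => exact ⟨_, _, rfl, .parR h hn⟩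
    | parR h hn => exact ⟨_, _, rfl, .parL h hn⟩
    | parSync h h' ha => exact ⟨_, _, rfl, .parSync h' h ha⟩
  generalize hE : Expr.par S P Q = E at h
  induction h generalizing P Q with
  | top => exact .top
  | act hs _ ih => subst hE; obtain ⟨P', Q', rfl, hs'⟩ := step hs; exact .act hs' (ih rfl)
  | tau hs _ ih => subst hE; obtain ⟨P', Q', rfl, hs'⟩ := step hs; exact .tau hs' (ih rfl)
  | refusal h1 h2 _ ih =>
    subst hE
    have hr := Refuses.par_symm ⟨h2, h1⟩
    exact .refusal hr.2 hr.1 (ih rfl)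
  | timeoutRef h1 h2 hs _ ih =>
    subst hE
    have hr := Refuses.par_symm ⟨h2, h1⟩
    obtain ⟨P', Q', rfl, hs'⟩ := step hs
    exact .timeoutRef hr.2 hr.1 hs' (ih rfl)
  | timeoutAct h1 h2 hs _ ha ih =>
    subst hE
    have hr := Refuses.par_symm ⟨h2, h1⟩
    obtain ⟨P', Q', rfl, hs'⟩ := step hs
    exact .timeoutAct hr.2 hr.1 hs' (ih rfl) ha

theorem fft_par_left {S P Q a l σ} (ha : a ∉ S) (hP : fft P (Sum.inl a :: l))
    (h : ∀ P', fft P' l → fft (.par S P' Q) σ) : fft (.par S P Q) (Sum.inl a :: σ) := by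
  generalize hσ : (Sum.inl a :: l : PFT) = ρ at hP
  induction hP with
  | top => cases hσ
  | act hs h' _ => cases hσ; exact .act (.parL hs (notIn_act ha)) (h _ h')
  | tau hs _ ih => exact .tau (.parL hs (notIn_tau S)) (ih hσ)
  | refusal => cases hσ
  | timeoutRef => cases hσ
  | timeoutAct => cases hσ

theorem fft_par_sync {S P Q a l r σ} (ha : a ∈ S) (hP : fft P (Sum.inl a :: l))
    (hQ : fft Q (Sum.inl a :: r))
    (h : ∀ P' Q', fft P' l → fft Q' r → fft (.par S P' Q') σ) :
    fft (.par S P Q) (Sum.inl a :: σ) := by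
  generalize hσ : (Sum.inl a :: l : PFT) = ρ at hP
  induction hP with
  | top => cases hσ
  | tau hs _ ih => exact .tau (.parL hs (notIn_tau S)) (ih hσ)
  | refusal => cases hσ
  | timeoutRef => cases hσ
  | timeoutAct => cases hσ
  | act hs h' ih' =>
    clear ih'
    cases hσ
    generalize hσ : (Sum.inl a :: r : PFT) = ρ at hQ
    induction hQ with
    | top => cases hσ
    | tau hs _ ih => exact .tau (.parR hs (notIn_tau S)) (ih hσ)
    | refusal => cases hσ
    | timeoutRef => cases hσ
    | timeoutAct => cases hσ
    | act hs' hQ _ => cases hσ; exact .act (.parSync hs hs' ha) (h _ _ h' hQ)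

/-- If a system-ended refusal set occurs on the left, then the trace continues
with the action ending it. -/
theorem Split.head_of_startsIn {S X XL XR σ l r a} (h : Split S σ (Sum.inl a :: l) r)
    (hXL : a ∈ XL) (h1 : StartsIn X σ) (h2 : ¬ StartsIn XR r) (hL : XL \ S = X \ S)
    (hR : XR \ S = X \ S) (hS : (XL ∩ S) ∪ (XR ∩ S) = X ∩ S) :
    a ∈ X ∧ ∃ σ', σ = Sum.inl a :: σ' := by
  have haX : a ∈ X := by
    have h1 := Set.ext_iff.1 hL a
    have h3 := Set.ext_iff.1 hS a
    simp only [Set.mem_sdiff, Set.mem_union, Set.mem_inter_iff] at h1 h3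
    tauto
  refine ⟨haX, ?_⟩
  cases h with
  | sync => exact ⟨_, rfl⟩
  | left => exact ⟨_, rfl⟩
  | @right b _ _ r hb _ =>
    obtain ⟨c, hc, hh⟩ := h1
    obtain rfl : b = c := by simpa using hh
    have : b ∈ XR \ S := hR ▸ ⟨hc, hb⟩
    exact absurd ⟨b, this.1, rfl⟩ h2

theorem fft_par_timeoutAct {S X XL XR P P' Q a σ l r}
    (ih : ∀ P Q, fft P (Sum.inl a :: l) → fft Q r → fft (.par S P Q) σ)
    (hsp : Split S σ (Sum.inl a :: l) r) (h1 : StartsIn X σ) (h2 : ¬ StartsIn XR r)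
    (hL : XL \ S = X \ S) (hR : XR \ S = X \ S) (hS : (XL ∩ S) ∪ (XR ∩ S) = X ∩ S)
    (hP : Refuses P XL) (ht : Step P .timeout P') (hP' : fft P' (Sum.inl a :: l)) (ha : a ∈ XL)
    (hQ : fft Q (Sum.inr XR :: r)) : fft (.par S P Q) (Sum.inr X :: σ) := by
  generalize hσ : (Sum.inr XR :: r : PFT) = ρ at hQ
  induction hQ with
  | top => cases hσ
  | act => cases hσ
  | tau hs _ ih' => exact .tau (.parR hs (notIn_tau S)) (ih' hσ)
  | refusal h3 h4 h5 _ =>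
    cases hσ
    have hr := hP.par ⟨h4, h3⟩ hL hR hS
    obtain ⟨haX, σ', rfl⟩ := hsp.head_of_startsIn ha h1 h2 hL hR hS
    exact .timeoutAct hr.2 hr.1 (.parL ht (notIn_timeout S)) (ih _ _ hP' h5) haX
  | timeoutRef h3 h4 hs _ ih' =>
    cases hσ
    have hr := hP.par ⟨h4, h3⟩ hL hR hS
    exact .timeoutRef hr.2 hr.1 (.parR hs (notIn_timeout S)) (ih' rfl)
  | timeoutAct _ _ _ _ hb _ => cases hσ; exact absurd ⟨_, hb, rfl⟩ h2

theorem fft_par_timeoutRef {S X XL XR P P' Q σ r}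
    (hL : XL \ S = X \ S) (hR : XR \ S = X \ S) (hS : (XL ∩ S) ∪ (XR ∩ S) = X ∩ S)
    (hP : Refuses P XL) (ht : Step P .timeout P')
    (hP' : ∀ Q, fft Q (Sum.inr XR :: r) → fft (.par S P' Q) (Sum.inr X :: σ))
    (hQ : fft Q (Sum.inr XR :: r)) : fft (.par S P Q) (Sum.inr X :: σ) := by
  have key : ∀ {Q}, Refuses Q XR → fft Q (Sum.inr XR :: r) →
      fft (.par S P Q) (Sum.inr X :: σ) := fun hr h =>
    have hr := hP.par hr hL hR hS
    .timeoutRef hr.2 hr.1 (.parL ht (notIn_timeout S)) (hP' _ h)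
  generalize hσ : (Sum.inr XR :: r : PFT) = ρ at hQ
  induction hQ with
  | top => cases hσ
  | act => cases hσ
  | tau hs _ ih => exact .tau (.parR hs (notIn_tau S)) (ih hσ)
  | refusal h3 h4 h5 _ => cases hσ; exact key ⟨h4, h3⟩ (.refusal h3 h4 h5)
  | timeoutRef h3 h4 h5 h6 _ => cases hσ; exact key ⟨h4, h3⟩ (.timeoutRef h3 h4 h5 h6)
  | timeoutAct h3 h4 h5 h6 h7 _ => cases hσ; exact key ⟨h4, h3⟩ (.timeoutAct h3 h4 h5 h6 h7)

theorem Split.fft_par {S σ l r} (h : Split S σ l r) {P Q} (hP : fft P l) (hQ : fft Q r) :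
    fft (.par S P Q) σ := by
  induction h generalizing P Q with
  | nil => exact .top
  | sync ha _ ih => exact fft_par_sync ha hP hQ fun _ _ h h' => ih h h'
  | left ha _ ih => exact fft_par_left ha hP fun _ h => ih h hQ
  | right ha _ ih => exact fft_par_symm (fft_par_left ha hQ fun _ h => fft_par_symm (ih hP h))
  | @refusal X XL XR σ l r h1 h2 hL hR hS hsp ih =>
    generalize hσ : (Sum.inr XL :: l : PFT) = ρ at hP
    induction hP generalizing Q with
    | top => cases hσ
    | act => cases hσ
    | tau hs _ ih' => exact .tau (.parL hs (notIn_tau S)) (ih' hQ hσ)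
    | timeoutRef h3 h4 hs _ ih' =>
      cases hσ
      exact fft_par_timeoutRef hL hR hS ⟨h4, h3⟩ hs (fun _ h => ih' h rfl) hQ
    | timeoutAct h3 h4 hs h5 ha _ =>
      cases hσ
      have hst := startsIn_cons ha
      exact fft_par_timeoutAct (fun _ _ h h' => ih h h') hsp (h1.2 (.inl (hst _)))
        (fun h => h2 ⟨hst _, h⟩) hL hR hS ⟨h4, h3⟩ hs h5 ha hQ
    | refusal h3 h4 h5 _ =>
      cases hσ
      generalize hσ : (Sum.inr XR :: r : PFT) = ρ at hQ
      induction hQ with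
      | top => cases hσ
      | act => cases hσ
      | tau hs _ ih' => exact .tau (.parR hs (notIn_tau S)) (ih' hσ)
      | refusal h6 h7 h8 _ =>
        cases hσ
        have hr := Refuses.par ⟨h4, h3⟩ ⟨h7, h6⟩ hL hR hS
        exact .refusal hr.2 hr.1 (ih h5 h8)
      | timeoutRef h6 h7 hs _ ih' =>
        cases hσ
        have hr := Refuses.par ⟨h4, h3⟩ ⟨h7, h6⟩ hL hR hS
        exact .timeoutRef hr.2 hr.1 (.parR hs (notIn_timeout S)) (ih' rfl)
      | timeoutAct h6 h7 hs h8 ha _ =>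
        cases hσ
        have hst := startsIn_cons ha
        exact fft_par_symm <| fft_par_timeoutAct (fun _ _ h h' => fft_par_symm (ih h' h)) hsp.symm
          (h1.2 (.inr (hst _))) (fun h => h2 ⟨h, hst _⟩) hR hL (by rw [Set.union_comm, hS])
          ⟨h7, h6⟩ hs h8 ha (.refusal h3 h4 h5)

theorem fft_dedup {P σ X ρ} (h : fft P (σ ++ Sum.inr X :: Sum.inr X :: ρ)) :
    fft P (σ ++ Sum.inr X :: ρ) := by
  generalize hτ : (σ ++ Sum.inr X :: Sum.inr X :: ρ : PFT) = τ at h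
  induction h generalizing σ with
  | top => simp at hτ
  | act hs _ ih =>
    cases σ with
    | nil => cases hτ
    | cons e σ => cases hτ; exact .act hs (ih rfl)
  | tau hs _ ih => exact .tau hs (ih hτ)
  | refusal h1 h2 h3 ih =>
    cases σ with
    | nil => cases hτ; exact h3
    | cons e σ => cases hτ; exact .refusal h1 h2 (ih rfl)
  | timeoutRef h1 h2 hs _ ih =>
    cases σ with
    | nil => cases hτ; exact .timeoutRef h1 h2 hs (ih (σ := []) rfl)
    | cons e σ => cases hτ; exact .timeoutRef h1 h2 hs (ih (σ := _ :: σ) rfl)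
  | timeoutAct h1 h2 hs _ ha ih =>
    cases σ with
    | nil => cases hτ
    | cons e σ =>
      cases σ with
      | nil => cases hτ
      | cons e' σ => cases hτ; exact .timeoutAct h1 h2 hs (ih (σ := _ :: σ) rfl) ha

/-! ### Traces of the parallel composition are collapsed composed traces -/

/-- `Stutter σ τ`: the trace `τ` results from `σ` by repeating refusal sets. -/
inductive Stutter : PFT → PFT → Prop
  | nil : Stutter [] []
  | cons {e σ τ} : Stutter σ τ → Stutter (e :: σ) (e :: τ)
  | dup {X σ τ} : Stutter (Sum.inr X :: σ) (Sum.inr X :: τ) →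
      Stutter (Sum.inr X :: σ) (Sum.inr X :: Sum.inr X :: τ)

theorem Stutter.head?_eq {σ τ} (h : Stutter σ τ) : τ.head? = σ.head? := by
  cases h <;> rfl

theorem Stutter.eq_cons {e σ τ} (h : Stutter (e :: σ) τ) : ∃ τ', τ = e :: τ' := by
  cases h <;> exact ⟨_, rfl⟩

theorem Stutter.startsIn_iff {X σ τ} (h : Stutter σ τ) : StartsIn X τ ↔ StartsIn X σ := by
  simp [StartsIn, h.head?_eq]

theorem Stutter.collapse {p : PFT → Prop}
    (hp : ∀ σ X ρ, p (σ ++ Sum.inr X :: Sum.inr X :: ρ) → p (σ ++ Sum.inr X :: ρ))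
    {σ τ} (h : Stutter σ τ) (π : PFT) (hτ : p (π ++ τ)) : p (π ++ σ) := by
  induction h generalizing π with
  | nil => exact hτ
  | @cons e σ τ _ ih => simpa using ih (π ++ [e]) (by simpa using hτ)
  | dup _ ih => exact ih π (hp _ _ _ hτ)

/-- The actions of `X` outside `S`, and those in `S` that `P` cannot perform initially. -/
def refusedPart (S : Set ℕ) (P : Expr) (X : Set ℕ) : Set ℕ :=
  {a | a ∈ X ∧ (a ∈ S → a ∉ initials P)}

theorem Refuses.left {S P Q X} (h : Refuses (.par S P Q) X) :
    Refuses P (refusedPart S P X) := by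
  refine ⟨(stable_par_iff.1 h.1).1, fun a ha hi => ?_⟩
  have := h.2 a ha.1
  have := ha.2
  rw [mem_initials_par_iff] at *
  tauto

theorem refusedPart_diff {S P X} : refusedPart S P X \ S = X \ S := by
  ext a; simp only [refusedPart, Set.mem_sdiff, Set.mem_ofPred_eq]; tauto

theorem Refuses.refusedPart_union {S P Q X} (h : Refuses (.par S P Q) X) :
    (refusedPart S P X ∩ S) ∪ (refusedPart S Q X ∩ S) = X ∩ S := by
  ext a
  have := h.2 a
  rw [mem_initials_par_iff] at this
  simp only [refusedPart, Set.mem_inter_iff, Set.mem_union, Set.mem_ofPred_eq]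
  tauto

theorem not_startsIn_refusal {X Y : Set ℕ} {σ : PFT} : ¬ StartsIn X (Sum.inr Y :: σ) := by
  simp [StartsIn]

theorem Split.exists_dup_timeout {S P P' Q X σ l r} (hr : Refuses (.par S P Q) X)
    (h : Split S (Sum.inr X :: σ) l r) (hP' : fft P' l) (hQ : fft Q r) :
    ∃ Y Z, Split S (Sum.inr X :: Sum.inr X :: σ) (Sum.inr Y :: l) (Sum.inr Z :: r) ∧
      Refuses P Y ∧ fft P' (Sum.inr Y :: l) ∧ fft Q (Sum.inr Z :: r) := by
  have h' := h
  cases h with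
  | @refusal _ XL XR _ l r h1 h2 hL hR hS hsp =>
    have hQs := (stable_par_iff.1 hr.1).2
    have hQR := refuses_of_fft hQs hQ
    refine ⟨refusedPart S P X ∩ XL, refusedPart S Q X, ?_, hr.left.mono Set.inter_subset_left,
      fft_cons_subset Set.inter_subset_right hP',
      .refusal hr.par_symm.left.2 hQs hQ⟩
    refine .refusal (by simp [not_startsIn_refusal]) (by simp [not_startsIn_refusal]) ?_
      refusedPart_diff ?_ h'
    · ext a
      have h1 := Set.ext_iff.1 hL a
      simp only [refusedPart, Set.mem_sdiff, Set.mem_inter_iff, Set.mem_ofPred_eq] at h1 ⊢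
      grind
    · ext a
      have h3 := Set.ext_iff.1 hS a
      have h4 := hr.2 a
      have h5 := hQR.2 a
      rw [mem_initials_par_iff] at h4
      simp only [refusedPart, Set.mem_inter_iff, Set.mem_union, Set.mem_ofPred_eq] at h3 ⊢
      grind

theorem Split.exists_timeoutAct {S P P' Q X a σ l r} (hr : Refuses (.par S P Q) X)
    (ha : a ∈ X) (ht : Step P .timeout P')
    (h : Split S (Sum.inl a :: σ) l r) (hP' : fft P' l) (hQ : fft Q r) :
    ∃ l' r', Split S (Sum.inr X :: Sum.inl a :: σ) l' r' ∧ fft P l' ∧ fft Q r' := by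
  have hPr := hr.left
  have hQr := hr.par_symm.left
  have hni := hr.2 a ha
  rw [mem_initials_par_iff] at hni
  have hR := hQr.not_startsIn hQ
  have hX : StartsIn X (Sum.inl a :: σ) := ⟨a, ha, rfl⟩
  obtain ⟨l', rfl, hal⟩ : ∃ l', l = Sum.inl a :: l' ∧ a ∈ refusedPart S P X := by
    cases h with
    | sync haS _ =>
      have := mem_initials_of_fft hQr.1 hQ
      exact ⟨_, rfl, ha, by tauto⟩
    | left haS _ => exact ⟨_, rfl, ha, fun h => absurd h haS⟩
    | right haS _ =>
      have := mem_initials_of_fft hQr.1 hQ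
      tauto
  have hL : StartsIn (refusedPart S P X) (Sum.inl a :: l') := ⟨a, hal, rfl⟩
  exact ⟨_, _, .refusal (iff_of_true hX (.inl hL)) (fun h => hR h.2) refusedPart_diff
    refusedPart_diff hr.refusedPart_union h, .timeoutAct hPr.2 hPr.1 ht hP' hal,
    .refusal hQr.2 hQr.1 hQ⟩

theorem exists_split_of_fft_par {S P Q σ} (h : fft (.par S P Q) σ) :
    ∃ τ l r, Stutter σ τ ∧ Split S τ l r ∧ fft P l ∧ fft Q r := by
  generalize hE : Expr.par S P Q = E at h
  induction h generalizing P Q with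
  | top => exact ⟨[], [], [], .nil, .nil, .top, .top⟩
  | act hs _ ih =>
    subst hE
    cases hs with
    | parL hs hn =>
      obtain ⟨τ, l, r, h1, h2, h3, h4⟩ := ih rfl
      exact ⟨_, _, _, h1.cons, .left (hn _ rfl) h2, .act hs h3, h4⟩
    | parR hs hn =>
      obtain ⟨τ, l, r, h1, h2, h3, h4⟩ := ih rfl
      exact ⟨_, _, _, h1.cons, .right (hn _ rfl) h2, h3, .act hs h4⟩
    | parSync hs hs' ha =>
      obtain ⟨τ, l, r, h1, h2, h3, h4⟩ := ih rfl
      exact ⟨_, _, _, h1.cons, .sync ha h2, .act hs h3, .act hs' h4⟩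
  | tau hs _ ih =>
    subst hE
    cases hs with
    | parL hs _ =>
      obtain ⟨τ, l, r, h1, h2, h3, h4⟩ := ih rfl
      exact ⟨_, _, _, h1, h2, .tau hs h3, h4⟩
    | parR hs _ =>
      obtain ⟨τ, l, r, h1, h2, h3, h4⟩ := ih rfl
      exact ⟨_, _, _, h1, h2, h3, .tau hs h4⟩
  | refusal hi hst hf ih =>
    subst hE
    have hr : Refuses _ _ := ⟨hst, hi⟩
    obtain ⟨τ, l, r, h1, h2, h3, h4⟩ := ih rfl
    have hP := hr.left
    have hQ := hr.par_symm.left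
    have hX := hr.not_startsIn hf
    rw [← h1.startsIn_iff] at hX
    have hL := hP.not_startsIn h3
    have hR := hQ.not_startsIn h4
    exact ⟨_, _, _, h1.cons, .refusal (by tauto) (by tauto) refusedPart_diff refusedPart_diff
      hr.refusedPart_union h2, .refusal hP.2 hP.1 h3, .refusal hQ.2 hQ.1 h4⟩
  | timeoutRef hi hst hs _ ih =>
    subst hE
    have hr : Refuses _ _ := ⟨hst, hi⟩
    cases hs with
    | parL hs _ =>
      obtain ⟨τ, l, r, h1, h2, h3, h4⟩ := ih rfl
      obtain ⟨τ, rfl⟩ := h1.eq_cons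
      obtain ⟨Y, Z, h5, h6, h7, h8⟩ := h2.exists_dup_timeout hr h3 h4
      exact ⟨_, _, _, h1.dup, h5, .timeoutRef h6.2 h6.1 hs h7, h8⟩
    | parR hs _ =>
      obtain ⟨τ, l, r, h1, h2, h3, h4⟩ := ih rfl
      obtain ⟨τ, rfl⟩ := h1.eq_cons
      obtain ⟨Y, Z, h5, h6, h7, h8⟩ := h2.symm.exists_dup_timeout hr.par_symm h4 h3
      exact ⟨_, _, _, h1.dup, h5.symm, h8, .timeoutRef h6.2 h6.1 hs h7⟩
  | timeoutAct hi hst hs _ ha ih =>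
    subst hE
    have hr : Refuses _ _ := ⟨hst, hi⟩
    cases hs with
    | parL hs _ =>
      obtain ⟨τ, l, r, h1, h2, h3, h4⟩ := ih rfl
      obtain ⟨τ, rfl⟩ := h1.eq_cons
      obtain ⟨l', r', h5, h6, h7⟩ := h2.exists_timeoutAct hr ha hs h3 h4
      exact ⟨_, _, _, h1.cons, h5, h6, h7⟩
    | parR hs _ =>
      obtain ⟨τ, l, r, h1, h2, h3, h4⟩ := ih rfl
      obtain ⟨τ, rfl⟩ := h1.eq_cons
      obtain ⟨l', r', h5, h6, h7⟩ := h2.symm.exists_timeoutAct hr.par_symm ha hs h4 h3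
      exact ⟨_, _, _, h1.cons, h5.symm, h7, h6⟩

/-! ### Rooted traces -/

theorem plain_mem_rfftSet {P σ} : RPFT.plain σ ∈ rfftSet P ↔ fft P σ := by
  simp [rfftSet]

theorem st_mem_rfftSet {P} : RPFT.st ∈ rfftSet P ↔ stable P := by
  simp [rfftSet]

theorem rooted_mem_rfftSet {P X σ} : RPFT.rooted X σ ∈ rfftSet P ↔
    Refuses P X ∧ ∃ P', Step P .timeout P' ∧ fft P' (Sum.inr X :: σ) := by
  simp [rfftSet, Refuses, and_assoc]

theorem postst_mem_rfftSet {P} : RPFT.postst ∈ rfftSet P ↔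
    ¬ stable P ∧ fft P [Sum.inr ∅] := by
  simp [rfftSet, stable]

theorem plain_mem_rparTraces {S F G σ} : RPFT.plain σ ∈ rparTraces S F G ↔
    ∃ l r, Split S σ l r ∧ RPFT.plain l ∈ F ∧ RPFT.plain r ∈ G := by
  constructor
  · rintro (⟨_, L, R, hσ, h, hF, hG⟩ | ⟨_, _, _, _, ⟨⟩, _⟩ | ⟨⟨⟩, _⟩ | ⟨⟨⟩, _⟩)
    cases hσ
    exact ⟨_, _, h.split, hF, hG⟩
  · rintro ⟨l, r, h, hF, hG⟩
    obtain ⟨L, R, hv, rfl, rfl⟩ := h.exists_validDecomp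
    exact .inl ⟨_, L, R, rfl, hv, hF, hG⟩

theorem rooted_mem_rparTraces {S F G X σ} : RPFT.rooted X σ ∈ rparTraces S F G ↔
    RPFT.st ∈ F ∧ RPFT.st ∈ G ∧
    ∃ XL l XR r, Split S (Sum.inr X :: σ) (Sum.inr XL :: l) (Sum.inr XR :: r) ∧
      ((RPFT.rooted XL l ∈ F ∧ RPFT.plain (Sum.inr XR :: r) ∈ G) ∨
       (RPFT.plain (Sum.inr XL :: l) ∈ F ∧ RPFT.rooted XR r ∈ G)) := by
  constructor
  · rintro (⟨_, _, _, ⟨⟩, _⟩ | ⟨_, _, L, R, ⟨⟩, h, hF, hG, h'⟩ | ⟨⟨⟩, _⟩ | ⟨⟨⟩, _⟩)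
    refine ⟨hF, hG, ?_⟩
    have hs := h.split
    rcases h' with ⟨XL, l, hl, h1, h2⟩ | ⟨XR, r, hr, h1, h2⟩
    · rw [hl] at hs
      obtain ⟨XR, r, hr⟩ := hs.exists_right
      exact ⟨_, _, _, _, hr ▸ hs, .inl ⟨h1, hr ▸ h2⟩⟩
    · rw [hr] at hs
      obtain ⟨XL, l, hl⟩ := hs.symm.exists_right
      exact ⟨_, _, _, _, hl ▸ hs, .inr ⟨hl ▸ h1, h2⟩⟩
  · rintro ⟨hF, hG, XL, l, XR, r, h, h'⟩
    obtain ⟨L, R, h, hl, hr⟩ := h.exists_validDecomp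
    refine .inr (.inl ⟨X, σ, L, R, rfl, h, hF, hG, ?_⟩)
    rcases h' with ⟨h1, h2⟩ | ⟨h1, h2⟩
    · exact .inl ⟨XL, l, hl, h1, hr ▸ h2⟩
    · exact .inr ⟨XR, r, hr, hl ▸ h1, h2⟩

theorem st_mem_rparTraces {S F G} : RPFT.st ∈ rparTraces S F G ↔
    RPFT.st ∈ F ∧ RPFT.st ∈ G := by
  simp [rparTraces]

theorem postst_mem_rparTraces {S F G} : RPFT.postst ∈ rparTraces S F G ↔
    (RPFT.postst ∈ F ∧ RPFT.postst ∈ G) ∨ (RPFT.postst ∈ F ∧ RPFT.st ∈ G) ∨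
      (RPFT.st ∈ F ∧ RPFT.postst ∈ G) := by
  simp [rparTraces]

theorem fft_par_empty_iff {S P Q} : fft (.par S P Q) [Sum.inr ∅] ↔
    fft P [Sum.inr ∅] ∧ fft Q [Sum.inr ∅] := by
  constructor
  · intro h
    obtain ⟨τ, l, r, h1, h2, h3, h4⟩ := exists_split_of_fft_par h
    obtain ⟨τ, rfl⟩ := h1.eq_cons
    cases h2 with
    | refusal =>
      exact ⟨fft_empty_of_fft_cons h3, fft_empty_of_fft_cons h4⟩
  · rintro ⟨h1, h2⟩
    exact Split.fft_par
      (.refusal (by simp [StartsIn]) (by simp [StartsIn]) rfl rfl (by simp) .nil) h1 h2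

theorem rcol_subset_rfftSet {P r} {F : Set RPFT} (hF : F ⊆ rfftSet P) (h : rcol F r) :
    r ∈ rfftSet P := by
  induction h with
  | base h => exact hF h
  | dupPlain _ ih =>
    rw [plain_mem_rfftSet] at ih ⊢
    exact fft_dedup ih
  | @dupRooted Y σ X ρ _ ih =>
    rw [rooted_mem_rfftSet] at ih ⊢
    obtain ⟨h1, P', h2, h3⟩ := ih
    exact ⟨h1, P', h2, fft_dedup (σ := Sum.inr Y :: σ) h3⟩
  | dupRootedHead _ ih =>
    rw [rooted_mem_rfftSet] at ih ⊢
    obtain ⟨h1, P', h2, h3⟩ := ih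
    exact ⟨h1, P', h2, fft_dedup (σ := []) h3⟩

theorem rparTraces_subset_rfftSet {S P Q} :
    rparTraces S (rfftSet P) (rfftSet Q) ⊆ rfftSet (.par S P Q) := by
  intro r hr
  cases r with
  | plain σ =>
    rw [plain_mem_rparTraces] at hr
    obtain ⟨l, r, h, hP, hQ⟩ := hr
    rw [plain_mem_rfftSet] at hP hQ ⊢
    exact h.fft_par hP hQ
  | rooted X σ =>
    rw [rooted_mem_rparTraces, st_mem_rfftSet, st_mem_rfftSet] at hr
    obtain ⟨hsP, hsQ, XL, l, XR, r, h, h'⟩ := hr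
    have h0 := h
    simp only [rooted_mem_rfftSet, plain_mem_rfftSet] at h' ⊢
    cases h0 with
    | refusal _ _ hL hR hS _ =>
      rcases h' with ⟨⟨hP, P', ht, hP'⟩, hQ⟩ | ⟨hP, hQ, Q', ht, hQ'⟩
      · exact ⟨hP.par (refuses_of_fft hsQ hQ) hL hR hS, _, .parL ht (notIn_timeout S),
          h.fft_par hP' hQ⟩
      · exact ⟨(refuses_of_fft hsP hP).par hQ hL hR hS, _, .parR ht (notIn_timeout S),
          h.fft_par hP hQ'⟩
  | st =>
    rw [st_mem_rparTraces] at hr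
    simp only [st_mem_rfftSet, stable_par_iff] at hr ⊢
    exact hr
  | postst =>
    rw [postst_mem_rparTraces] at hr
    simp only [postst_mem_rfftSet, st_mem_rfftSet, stable_par_iff, fft_par_empty_iff] at hr ⊢
    have hst : ∀ {P}, stable P → fft P [Sum.inr ∅] := fun h => .refusal (by simp) h .top
    have h1 := @hst P
    have h2 := @hst Q
    tauto

theorem rfftSet_par_subset {S P Q} :
    rfftSet (.par S P Q) ⊆ rcolSet (rparTraces S (rfftSet P) (rfftSet Q)) := by
  intro r hr
  cases r with
  | plain σ =>
    rw [plain_mem_rfftSet] at hr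
    obtain ⟨τ, l, r, h1, h2, h3, h4⟩ := exists_split_of_fft_par hr
    refine h1.collapse (p := fun σ => rcol _ (.plain σ)) (fun _ _ _ h => .dupPlain h) []
      (.base (plain_mem_rparTraces.2 ⟨l, r, h2, ?_, ?_⟩)) <;> rwa [plain_mem_rfftSet]
  | rooted X σ =>
    rw [rooted_mem_rfftSet] at hr
    obtain ⟨hr, E, ht, h⟩ := hr
    have hs := stable_par_iff.1 hr.1
    refine .dupRootedHead ?_
    suffices ∃ τ, Stutter (Sum.inr X :: σ) τ ∧
        RPFT.rooted X τ ∈ rparTraces S (rfftSet P) (rfftSet Q) by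
      obtain ⟨τ, h1, h2⟩ := this
      exact h1.collapse (p := fun σ => rcol _ (.rooted X σ)) (fun _ _ _ h => .dupRooted h) []
        (.base h2)
    simp only [rooted_mem_rparTraces, st_mem_rfftSet, rooted_mem_rfftSet, plain_mem_rfftSet]
    cases ht with
    | parL ht _ =>
      obtain ⟨τ, l, r, h1, h2, h3, h4⟩ := exists_split_of_fft_par h
      obtain ⟨τ, rfl⟩ := h1.eq_cons
      obtain ⟨Y, Z, h5, h6, h7, h8⟩ := h2.exists_dup_timeout hr h3 h4
      exact ⟨_, h1, hs.1, hs.2, _, _, _, _, h5, .inl ⟨⟨h6, _, ht, h7⟩, h8⟩⟩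
    | parR ht _ =>
      obtain ⟨τ, l, r, h1, h2, h3, h4⟩ := exists_split_of_fft_par h
      obtain ⟨τ, rfl⟩ := h1.eq_cons
      obtain ⟨Y, Z, h5, h6, h7, h8⟩ := h2.symm.exists_dup_timeout hr.par_symm h4 h3
      exact ⟨_, h1, hs.1, hs.2, _, _, _, _, h5.symm, .inr ⟨h8, h6, _, ht, h7⟩⟩
  | st =>
    refine .base (st_mem_rparTraces.2 ?_)
    simp only [st_mem_rfftSet, stable_par_iff] at hr ⊢
    exact hr
  | postst =>
    refine .base (postst_mem_rparTraces.2 ?_)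
    simp only [postst_mem_rfftSet, st_mem_rfftSet, stable_par_iff, fft_par_empty_iff] at hr ⊢
    tauto

/-- For all processes `P` and `Q` and every `S ⊆ A`:
`rfft(P ∥_S Q) = col(rfft(P) ∥_S rfft(Q))`. -/
theorem rfft_par_explicit (S : Set ℕ) (P Q : Expr)
    (hP : IsProcess P) (hQ : IsProcess Q) :
    rfftSet (.par S P Q) = rcolSet (rparTraces S (rfftSet P) (rfftSet Q)) :=
  Set.Subset.antisymm rfftSet_par_subset
    fun _ h => rcol_subset_rfftSet rparTraces_subset_rfftSet h
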